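/- (Stages 2–3 of the QRAT refutation, quantitative form) For every n ≥ 1 there is a resolution refutation of the reduced SquaredEquality CNF eq²_red(n) in which at most 4n² clauses of the sequence are resolvents (the rest being clauses of eq²_red(n)); in particular eq²_red(n) has a resolution refutation whose length is linear in the number of clauses of eq²_red(n). -/

import Mathlib

/-- Variables of the reduced SquaredEquality CNF: `x_i`, `y_j`, `t_{i,j}`. -/
inductive RV (n : ℕ) : Type where
  | X : Fin n → RV n
  | Y : Fin n → RV n
  | T : Fin n → Fin n → RV n
  deriving DecidableEq

/-- A literal is a variable together with a polarity. -/
abbrev Lit (n : ℕ) := RV n × Bool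

/-- A clause is a finite set of literals. -/
abbrev Clause (n : ℕ) := Finset (Lit n)

/-- Negation of a literal. -/
def negLit {n : ℕ} (ℓ : Lit n) : Lit n := (ℓ.1, !ℓ.2)

/-- The reduced SquaredEquality CNF `eq²_red(n)`, as a finite set of clauses. -/
def eq2red (n : ℕ) : Finset (Clause n) :=
  (Finset.univ.image fun p : Fin n × Fin n =>
    ({((RV.X p.1 : RV n), true), ((RV.Y p.2 : RV n), true),
      ((RV.T p.1 p.2 : RV n), true)} : Clause n)) ∪
  (Finset.univ.image fun p : Fin n × Fin n =>
    ({((RV.X p.1 : RV n), true), ((RV.Y p.2 : RV n), false),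
      ((RV.T p.1 p.2 : RV n), true)} : Clause n)) ∪
  (Finset.univ.image fun p : Fin n × Fin n =>
    ({((RV.X p.1 : RV n), false), ((RV.Y p.2 : RV n), true),
      ((RV.T p.1 p.2 : RV n), true)} : Clause n)) ∪
  (Finset.univ.image fun p : Fin n × Fin n =>
    ({((RV.X p.1 : RV n), false), ((RV.Y p.2 : RV n), false),
      ((RV.T p.1 p.2 : RV n), true)} : Clause n)) ∪
  {Finset.univ.image (fun p : Fin n × Fin n => ((RV.T p.1 p.2 : RV n), false))}

/-- `R` is the resolvent of clauses `A` and `B` on the literal `p`. -/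
def IsResolvent {n : ℕ} (A B R : Clause n) (p : Lit n) : Prop :=
  p ∈ A ∧ negLit p ∈ B ∧ R = A.erase p ∪ B.erase (negLit p)

/-- `L` is a resolution derivation from the clause set `F`: every entry of the
sequence either belongs to `F` or is a resolvent of two earlier entries. -/
def IsResDeriv {n : ℕ} (F : Finset (Clause n)) (L : List (Clause n)) : Prop :=
  ∀ k (hk : k < L.length), L[k] ∈ F ∨
    ∃ a b, ∃ (ha : a < k) (hb : b < k), ∃ p : Lit n,
      IsResolvent (L[a]'(ha.trans hk)) (L[b]'(hb.trans hk)) L[k] p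

theorem deriv_snoc {n : ℕ} {F : Finset (Clause n)} {L : List (Clause n)} (h : IsResDeriv F L)
    {A B R : Clause n} (p : Lit n) (hA : A ∈ L) (hB : B ∈ L) (hR : IsResolvent A B R p) :
    IsResDeriv F (L ++ [R]) := by
  intro k hk
  by_cases hkL : k < L.length
  · rcases h k hkL with h1 | ⟨a, b, ha, hb, q, hq⟩
    · left
      rw [List.getElem_append_left hkL]
      exact h1
    · right
      refine ⟨a, b, ha, hb, q, ?_⟩
      rw [List.getElem_append_left hkL, List.getElem_append_left (ha.trans hkL),
        List.getElem_append_left (hb.trans hkL)]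
      exact hq
  · have hk2 : k = L.length := by
      simp at hk
      omega
    subst hk2
    right
    obtain ⟨a, ha, rfl⟩ := List.getElem_of_mem hA
    obtain ⟨b, hb, rfl⟩ := List.getElem_of_mem hB
    refine ⟨a, b, ha, hb, p, ?_⟩
    rw [List.getElem_append_left ha, List.getElem_append_left hb]
    simpa using hR

def baseCl {n : ℕ} (i j : Fin n) (b c : Bool) : Clause n :=
  {((RV.X i : RV n), b), ((RV.Y j : RV n), c), ((RV.T i j : RV n), true)}

theorem baseCl_mem {n : ℕ} (i j : Fin n) (b c : Bool) : baseCl i j b c ∈ eq2red n := by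
  unfold eq2red baseCl
  simp only [Finset.mem_union, Finset.mem_image, Finset.mem_univ, true_and]
  cases b <;> cases c
  · exact Or.inl (Or.inr ⟨(i, j), rfl⟩)
  · exact Or.inl (Or.inl (Or.inr ⟨(i, j), rfl⟩))
  · exact Or.inl (Or.inl (Or.inl (Or.inr ⟨(i, j), rfl⟩)))
  · exact Or.inl (Or.inl (Or.inl (Or.inl ⟨(i, j), rfl⟩)))

theorem card_lower (n : ℕ) : 4 * n ^ 2 ≤ (eq2red n).card := by
  have h := Finset.card_le_card_of_injOn (s := (Finset.univ : Finset ((Fin n × Fin n) × (Bool × Bool))))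
    (t := eq2red n) (fun q => baseCl q.1.1 q.1.2 q.2.1 q.2.2) (fun q _ => baseCl_mem _ _ _ _) (by
      rintro ⟨⟨i, j⟩, b, c⟩ - ⟨⟨i', j'⟩, b', c'⟩ - h
      simp only at h
      have h1 : ((RV.X i : RV n), b) ∈ baseCl i' j' b' c' := by rw [← h]; simp [baseCl]
      have h2 : ((RV.Y j : RV n), c) ∈ baseCl i' j' b' c' := by rw [← h]; simp [baseCl]
      simp [baseCl] at h1 h2
      simp [h1, h2])
  simp at h
  nlinarith [h]

def negCl {n : ℕ} (s : Finset (Fin n × Fin n)) : Clause n :=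
  sᶜ.image (fun p : Fin n × Fin n => ((RV.T p.1 p.2 : RV n), false))

theorem res1 {n : ℕ} (i j : Fin n) (b : Bool) :
    IsResolvent (baseCl i j b true) (baseCl i j b false)
      {((RV.X i : RV n), b), ((RV.T i j : RV n), true)} (RV.Y j, true) := by
  refine ⟨by simp [baseCl], by simp [baseCl, negLit], ?_⟩
  ext ⟨v, d⟩
  cases v <;> simp [baseCl, negLit]

theorem res2 {n : ℕ} (i j : Fin n) :
    IsResolvent {((RV.X i : RV n), true), ((RV.T i j : RV n), true)}
      {((RV.X i : RV n), false), ((RV.T i j : RV n), true)}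
      {((RV.T i j : RV n), true)} (RV.X i, true) := by
  refine ⟨by simp, by simp [negLit], ?_⟩
  ext ⟨v, d⟩
  cases v <;> simp [negLit]

theorem res3 {n : ℕ} (i j : Fin n) (s : Finset (Fin n × Fin n)) (h : (i, j) ∉ s) :
    IsResolvent {((RV.T i j : RV n), true)} (negCl s) (negCl (insert (i, j) s))
      (RV.T i j, true) := by
  refine ⟨by simp, by simpa [negLit, negCl] using h, ?_⟩
  ext ⟨v, d⟩
  cases v <;> simp [negLit, negCl]
  grind

theorem chain {n : ℕ} (s : Finset (Fin n × Fin n)) :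
    ∃ M : List (Clause n), IsResDeriv (eq2red n) ((eq2red n).toList ++ M) ∧
      negCl s ∈ (eq2red n).toList ++ M ∧ M.length ≤ 4 * s.card := by
  induction s using Finset.induction_on with
  | empty =>
    refine ⟨[], ?_, ?_, by simp⟩
    · intro k hk
      left
      have key : ∀ C ∈ (eq2red n).toList ++ [], C ∈ eq2red n := fun C hC => by simpa using hC
      exact key _ (List.getElem_mem hk)
    · simp [eq2red, negCl]
  | insert p s hp ih =>
    obtain ⟨i, j⟩ := p
    obtain ⟨M, hM, hmem, hlen⟩ := ih
    have hb : ∀ b c, baseCl i j b c ∈ (eq2red n).toList := fun b c => by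
      simpa using baseCl_mem i j b c
    have d1 := deriv_snoc hM _ (List.mem_append_left _ (hb _ _))
      (List.mem_append_left _ (hb _ _)) (res1 i j true)
    have d2 := deriv_snoc d1 _ (List.mem_append_left _ (List.mem_append_left _ (hb _ _)))
      (List.mem_append_left _ (List.mem_append_left _ (hb _ _))) (res1 i j false)
    have d3 := deriv_snoc d2 _ (by simp) (by simp) (res2 i j)
    have d4 := deriv_snoc d3 _ (by simp)
      (List.mem_append_left _ (List.mem_append_left _ (List.mem_append_left _ hmem)))
      (res3 i j s hp)
    simp only [List.append_assoc] at d4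
    refine ⟨_, d4, by simp, ?_⟩
    rw [Finset.card_insert_of_notMem hp]
    simp
    omega

/-- Stages 2–3 of the QRAT refutation, quantitative form: for every `n ≥ 1` there is a
resolution refutation of `eq²_red(n)` in which at most `4n²` entries of the sequence
are resolvents (the rest being clauses of `eq²_red(n)`); in particular its length is
linear in the number of clauses of `eq²_red(n)`. -/
theorem reduced_squaredEquality_short_refutation (n : ℕ) (hn : 1 ≤ n) :
    ∃ L : List (Clause n),
      IsResDeriv (eq2red n) L ∧
      (∅ : Clause n) ∈ L ∧
      L.countP (fun Cl => decide (Cl ∉ eq2red n)) ≤ 4 * n ^ 2 ∧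
      L.length ≤ 2 * (eq2red n).card := by
  obtain ⟨M, hM, hmem, hlen⟩ := chain (Finset.univ : Finset (Fin n × Fin n))
  have hl : M.length ≤ 4 * n ^ 2 := by
    simp at hlen
    nlinarith [hlen]
  refine ⟨_, hM, by simpa [negCl] using hmem, ?_, ?_⟩
  · rw [List.countP_append]
    have h0 : (eq2red n).toList.countP (fun Cl => decide (Cl ∉ eq2red n)) = 0 := by
      rw [List.countP_eq_zero]
      intro a ha
      simpa using ha
    have h1 : M.countP (fun Cl => decide (Cl ∉ eq2red n)) ≤ M.length := List.countP_le_length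
    omega
  · have := card_lower n
    simp
    omega
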